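/- Let J be an at most countable index set, Λ = J × J, and let A be the operator acting on sequences on Λ by (Aa)_{λ_1,λ_2} = Σ_{μ_1,μ_2 ∈ J} K_{λ_1,λ_2,μ_1,μ_2} a_{μ_1,μ_2}. Suppose K ∘ c̃_3 ∈ ℓ^{1,∞,1,∞}, K ∘ c̃_4 ∈ ℓ^{1,∞,1,∞}, and moreover K ∈ ℓ^{1,∞}(Λ×Λ) and K ∘ c̃_0 ∈ ℓ^{1,∞}(Λ×Λ). Then A is bounded on ℓ^{p,q}(Λ) for every 1 ≤ p, q ≤ ∞. -/

import Mathlib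

noncomputable section

open scoped ENNReal

/-- The `ℓ^p` "norm" (`ℝ≥0∞`-valued) of an `ℝ≥0∞`-valued sequence. -/
def lpN {ι : Type*} (p : ℝ≥0∞) (F : ι → ℝ≥0∞) : ℝ≥0∞ :=
  if p = ∞ then ⨆ i, F i else (∑' i, F i ^ p.toReal) ^ (1 / p.toReal)

/-- Factorization of a sequence through a probability weight. -/
theorem exists_weight_le_lpN_mul {ι : Type*} {p : ℝ≥0∞} (hp : 1 ≤ p) (F : ι → ℝ≥0∞)
    (hF : lpN p F ≠ ∞) :
    ∃ w : ι → ℝ≥0∞, ∑' i, w i ≤ 1 ∧ ∀ i, F i ≤ lpN p F * w i ^ p.toReal⁻¹ := by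
  by_cases hp' : p = ∞
  · subst hp'
    exact ⟨0, by simp, fun i => by simpa [lpN] using le_iSup F i⟩
  have hpos : 0 < p.toReal := ENNReal.toReal_pos (by positivity) hp'
  have hN : lpN p F = (∑' i, F i ^ p.toReal) ^ p.toReal⁻¹ := by simp [lpN, hp']
  set S := ∑' i, F i ^ p.toReal with hS
  have hStop : S ≠ ∞ := by
    intro h
    rw [hN, h, ENNReal.top_rpow_of_pos (by positivity)] at hF
    exact hF rfl
  refine ⟨fun i => F i ^ p.toReal / S, ?_, fun i => ?_⟩
  · simp only [div_eq_mul_inv]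
    rw [ENNReal.tsum_mul_right]
    exact ENNReal.mul_inv_le_one S
  · have hi : F i ^ p.toReal ≤ S := ENNReal.le_tsum i
    have hdiv : F i ^ p.toReal ≤ S * (F i ^ p.toReal / S) := by
      by_cases h0 : S = 0
      · rw [h0] at hi ⊢
        simpa using hi
      · rw [ENNReal.mul_div_cancel h0 hStop]
    rw [hN, ← ENNReal.mul_rpow_of_nonneg _ _ (by positivity)]
    exact (ENNReal.le_rpow_inv_iff hpos).2 hdiv

/-- The `ℓ^p` norm is controlled by pairings with powers of probability weights. -/
theorem lpN_le_iSup_weight {ι : Type*} {p : ℝ≥0∞} (hp : 1 ≤ p) (F : ι → ℝ≥0∞) :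
    lpN p F ≤ ⨆ w : {w : ι → ℝ≥0∞ // ∑' i, w i ≤ 1},
      ∑' i, w.1 i ^ (1 - p.toReal⁻¹) * F i := by
  classical
  set D := ⨆ w : {w : ι → ℝ≥0∞ // ∑' i, w i ≤ 1}, ∑' i, w.1 i ^ (1 - p.toReal⁻¹) * F i with hD
  have le_D (w : ι → ℝ≥0∞) (hw : ∑' i, w i ≤ 1) :
      ∑' i, w i ^ (1 - p.toReal⁻¹) * F i ≤ D :=
    le_iSup (fun w : {w : ι → ℝ≥0∞ // ∑' i, w i ≤ 1} =>
      ∑' i, w.1 i ^ (1 - p.toReal⁻¹) * F i) ⟨w, hw⟩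
  have apply_le_D (i : ι) : F i ≤ D := by
    refine le_trans ?_ (le_D (Pi.single i 1) (by rw [tsum_pi_single]))
    refine le_trans ?_ (ENNReal.le_tsum i)
    simp
  by_cases hp' : p = ∞
  · rw [lpN, if_pos hp']
    exact iSup_le apply_le_D
  have hp1 : 1 ≤ p.toReal := by
    simpa using (ENNReal.toReal_le_toReal ENNReal.one_ne_top hp').2 hp
  have hpos : 0 < p.toReal := by linarith
  have hx : 0 ≤ 1 - p.toReal⁻¹ := by linarith [inv_le_one_of_one_le₀ hp1]
  rw [lpN, if_neg hp', one_div, ENNReal.rpow_inv_le_iff hpos, ENNReal.tsum_eq_iSup_sum]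
  refine iSup_le fun s => ?_
  rw [← ENNReal.rpow_inv_le_iff hpos]
  by_cases hfin : ∃ i, F i = ∞
  · obtain ⟨i, hi⟩ := hfin
    exact le_top.trans (hi ▸ apply_le_D i)
  push Not at hfin
  set S := ∑ i ∈ s, F i ^ p.toReal with hS
  by_cases hS0 : S = 0
  · rw [hS0, ENNReal.zero_rpow_of_pos (by positivity)]
    exact zero_le
  have hStop : S ≠ ∞ := ENNReal.sum_ne_top.2 fun i _ =>
    ENNReal.rpow_ne_top_of_nonneg hpos.le (hfin i)
  refine le_trans ?_ (le_D (fun i => if i ∈ s then F i ^ p.toReal / S else 0) ?_)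
  · refine le_trans ?_ (ENNReal.sum_le_tsum s)
    have key : ∀ i ∈ s, (if i ∈ s then F i ^ p.toReal / S else 0) ^ (1 - p.toReal⁻¹) * F i
        = F i ^ p.toReal * (S ^ (1 - p.toReal⁻¹))⁻¹ := by
      intro i hi
      rw [if_pos hi, ENNReal.div_rpow_of_nonneg _ _ hx, ← ENNReal.rpow_mul, div_eq_mul_inv,
        mul_right_comm]
      congr 1
      nth_rewrite 2 [← ENNReal.rpow_one (F i)]
      rw [← ENNReal.rpow_add_of_nonneg _ _ (by positivity) zero_le_one]
      congr 1
      field_simp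
      ring
    rw [Finset.sum_congr rfl key, ← Finset.sum_mul, ← hS, ← ENNReal.rpow_neg]
    nth_rewrite 2 [← ENNReal.rpow_one S]
    rw [← ENNReal.rpow_add _ _ hS0 hStop]
    exact le_of_eq (by congr 1; ring)
  · rw [tsum_eq_sum (s := s) (fun i hi => if_neg hi)]
    rw [Finset.sum_congr rfl fun i hi => if_pos hi]
    simp only [div_eq_mul_inv]
    rw [← Finset.sum_mul]
    exact ENNReal.mul_inv_le_one S

/-- Sums of suprema are suprema of sums over choice functions. -/
theorem tsum_iSup_le_iSup_tsum_apply {ι V : Type*} [Nonempty V] (g : ι → V → ℝ≥0∞) :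
    ∑' i, ⨆ v, g i v ≤ ⨆ c : ι → V, ∑' i, g i (c i) := by
  classical
  rw [ENNReal.tsum_eq_iSup_sum]
  refine iSup_le fun s => ?_
  have h (i : ι) : ⨆ v, g i v = ⨆ c : ι → V, g i (c i) :=
    ((Function.surjective_eval (β := fun _ : ι => V) i).iSup_comp (g i)).symm
  simp only [h]
  rw [ENNReal.finsetSum_iSup]
  · exact iSup_mono fun c => ENNReal.sum_le_tsum s
  · intro c d
    refine ⟨fun i => if g i (c i) ≤ g i (d i) then d i else c i, fun i => ?_⟩
    dsimp only
    split_ifs with hi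
    · exact ⟨hi, le_rfl⟩
    · exact ⟨le_rfl, (not_le.1 hi).le⟩

/-- Mixed norms are controlled by pairings with products of powers of probability weights. -/
theorem lpN_lpN_le_of_forall_weight {ι κ : Type*} {p q : ℝ≥0∞} (hp : 1 ≤ p) (hq : 1 ≤ q)
    (F : κ → ι → ℝ≥0∞) {C : ℝ≥0∞}
    (h : ∀ (t : κ → ℝ≥0∞) (w : κ → ι → ℝ≥0∞), ∑' j, t j ≤ 1 → (∀ j, ∑' i, w j i ≤ 1) →
      ∑' j, ∑' i, t j ^ (1 - q.toReal⁻¹) * w j i ^ (1 - p.toReal⁻¹) * F j i ≤ C) :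
    lpN q (fun j => lpN p (F j)) ≤ C := by
  refine (lpN_le_iSup_weight hq _).trans (iSup_le fun t => ?_)
  have : Nonempty {w : ι → ℝ≥0∞ // ∑' i, w i ≤ 1} := ⟨0, by simp⟩
  calc ∑' j, t.1 j ^ (1 - q.toReal⁻¹) * lpN p (F j)
      ≤ ∑' j, ⨆ w : {w : ι → ℝ≥0∞ // ∑' i, w i ≤ 1},
          t.1 j ^ (1 - q.toReal⁻¹) * ∑' i, w.1 i ^ (1 - p.toReal⁻¹) * F j i := by
        refine ENNReal.tsum_le_tsum fun j => ?_
        rw [← ENNReal.mul_iSup]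
        gcongr
        exact lpN_le_iSup_weight hp (F j)
    _ ≤ _ := tsum_iSup_le_iSup_tsum_apply _
    _ ≤ C := by
        refine iSup_le fun c => ?_
        simpa only [mul_assoc, ENNReal.tsum_mul_left] using
          h t.1 (fun j => (c j).1) t.2 fun j => (c j).2

theorem tsum_mul_le_iSup {ι : Type*} (g f : ι → ℝ≥0∞) (hg : ∑' i, g i ≤ 1) :
    ∑' i, g i * f i ≤ ⨆ i, f i :=
  calc ∑' i, g i * f i ≤ ∑' i, g i * ⨆ i, f i :=
        ENNReal.tsum_le_tsum fun i => by gcongr; exact le_iSup f i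
    _ ≤ 1 * ⨆ i, f i := by rw [ENNReal.tsum_mul_right]; gcongr
    _ = ⨆ i, f i := one_mul _

theorem tsum_weight_mul_le_iSup {I J L M : Type*} (k : I → J → L → M → ℝ≥0∞)
    (t : I → ℝ≥0∞) (u : J → L → ℝ≥0∞) (ht : ∑' i, t i ≤ 1) (hu : ∀ j, ∑' l, u j l ≤ 1) :
    ∑' i, ∑' j, ∑' l, ∑' m, k i j l m * (t i * u j l) ≤
      ⨆ i, ∑' j, ⨆ l, ∑' m, k i j l m := by
  refine le_trans (le_of_eq ?_) ((tsum_mul_le_iSup t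
    (fun i => ∑' j, ∑' l, u j l * ∑' m, k i j l m) ht).trans ?_)
  · simp only [← ENNReal.tsum_mul_left]
    congr! 8
    ring
  · exact iSup_mono fun i => ENNReal.tsum_le_tsum fun j => tsum_mul_le_iSup _ _ (hu j)

/-- A weighted geometric mean is at most the sum. -/
theorem rpow_mul_rpow_one_sub_le_add {x : ℝ} (h0 : 0 ≤ x) (h1 : x ≤ 1) (s t : ℝ≥0∞) :
    s ^ x * t ^ (1 - x) ≤ s + t :=
  calc s ^ x * t ^ (1 - x) ≤ (s + t) ^ x * (s + t) ^ (1 - x) := by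
        gcongr
        · exact le_self_add
        · exact le_add_self
    _ = s + t := by
        rw [← ENNReal.rpow_add_of_nonneg _ _ h0 (by linarith)]
        simp

theorem toReal_inv_mem_Icc {p : ℝ≥0∞} (hp : 1 ≤ p) : 0 ≤ p.toReal⁻¹ ∧ p.toReal⁻¹ ≤ 1 := by
  refine ⟨by positivity, ?_⟩
  rw [← ENNReal.toReal_inv]
  simpa using ENNReal.toReal_mono ENNReal.one_ne_top (ENNReal.inv_le_one.2 hp)

theorem tsum_mul_weight_le {ι κ : Type*} (s : κ → ℝ≥0∞) (u : κ → ι → ℝ≥0∞)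
    (hs : ∑' j, s j ≤ 1) (hu : ∀ j, ∑' i, u j i ≤ 1) :
    ∑' m : ι × κ, s m.2 * u m.2 m.1 ≤ 1 := by
  rw [ENNReal.tsum_prod', ENNReal.tsum_comm]
  simp only [ENNReal.tsum_mul_left]
  exact (tsum_mul_le_iSup s _ hs).trans (iSup_le hu)

/-- The weighted form attached to a nonnegative kernel is bounded by its four Schur constants. -/
theorem schur_weight_form_le {J : Type*} (k : J → J → J → J → ℝ≥0∞)
    (s t : J → ℝ≥0∞) (u w : J → J → ℝ≥0∞) (hs : ∑' j, s j ≤ 1) (ht : ∑' j, t j ≤ 1)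
    (hu : ∀ j, ∑' i, u j i ≤ 1) (hw : ∀ j, ∑' i, w j i ≤ 1) :
    ∑' l2, ∑' l1, ∑' m : J × J,
        k l1 l2 m.1 m.2 * ((s m.2 + t l2) * (u m.2 m.1 + w l2 l1)) ≤
      ((⨆ j4 : J, ∑' j3 : J, ⨆ j2 : J, ∑' j1 : J, k j2 j3 j1 j4) +
        ⨆ j4 : J, ∑' j3 : J, ⨆ j2 : J, ∑' j1 : J, k j1 j4 j2 j3) +
      ((⨆ m : J × J, ∑' l : J × J, k l.1 l.2 m.1 m.2) +
        ⨆ m : J × J, ∑' l : J × J, k m.1 m.2 l.1 l.2) := by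
  have e3 : ∑' l2, ∑' l1, ∑' m : J × J, k l1 l2 m.1 m.2 * (s m.2 * w l2 l1) ≤
      ⨆ j4 : J, ∑' j3 : J, ⨆ j2 : J, ∑' j1 : J, k j2 j3 j1 j4 := by
    refine le_trans (le_of_eq ?_)
      (tsum_weight_mul_le_iSup (fun j4 j3 j2 j1 => k j2 j3 j1 j4) s w hs hw)
    rw [ENNReal.tsum_comm]
    simp only [ENNReal.tsum_prod']
    rw [ENNReal.tsum_comm]
    refine Eq.trans ?_ ENNReal.tsum_comm
    refine tsum_congr fun l2 => ?_
    refine Eq.trans ?_ ENNReal.tsum_comm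
    exact tsum_congr fun l1 => ENNReal.tsum_comm
  have e4 : ∑' l2, ∑' l1, ∑' m : J × J, k l1 l2 m.1 m.2 * (t l2 * u m.2 m.1) ≤
      ⨆ j4 : J, ∑' j3 : J, ⨆ j2 : J, ∑' j1 : J, k j1 j4 j2 j3 := by
    refine le_trans (le_of_eq ?_)
      (tsum_weight_mul_le_iSup (fun j4 j3 j2 j1 => k j1 j4 j2 j3) t u ht hu)
    refine tsum_congr fun l2 => ?_
    rw [ENNReal.tsum_comm, ENNReal.tsum_prod', ENNReal.tsum_comm]
  have e0 : ∑' l2, ∑' l1, ∑' m : J × J, k l1 l2 m.1 m.2 * (s m.2 * u m.2 m.1) ≤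
      ⨆ m : J × J, ∑' l : J × J, k l.1 l.2 m.1 m.2 := by
    refine le_trans (le_of_eq ?_) (tsum_mul_le_iSup (fun m : J × J => s m.2 * u m.2 m.1)
      (fun m => ∑' l : J × J, k l.1 l.2 m.1 m.2) (tsum_mul_weight_le s u hs hu))
    simp only [← ENNReal.tsum_mul_left]
    rw [ENNReal.tsum_comm, ENNReal.tsum_comm (α := J × J) (β := J × J), ENNReal.tsum_prod']
    exact tsum_congr fun l1 => tsum_congr fun l2 => tsum_congr fun m => mul_comm _ _
  have e0' : ∑' l2, ∑' l1, ∑' m : J × J, k l1 l2 m.1 m.2 * (t l2 * w l2 l1) ≤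
      ⨆ m : J × J, ∑' l : J × J, k m.1 m.2 l.1 l.2 := by
    refine le_trans (le_of_eq ?_) (tsum_mul_le_iSup (fun m : J × J => t m.2 * w m.2 m.1)
      (fun m => ∑' l : J × J, k m.1 m.2 l.1 l.2) (tsum_mul_weight_le t w ht hw))
    simp only [← ENNReal.tsum_mul_left]
    rw [ENNReal.tsum_comm, ENNReal.tsum_prod']
    exact tsum_congr fun l1 => tsum_congr fun l2 => tsum_congr fun m => mul_comm _ _
  refine le_trans (le_of_eq ?_) (add_le_add (add_le_add e3 e4) (add_le_add e0 e0'))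
  simp only [← ENNReal.tsum_add]
  refine tsum_congr fun l2 => tsum_congr fun l1 => tsum_congr fun m => ?_
  ring

/-- **Boundedness on all `ℓ^{p,q}`** (Proposition 4.1 (iii) of the paper).
Let `J` be an at most countable index set and `A` the operator on sequences on `Λ = J × J`
given by `(Aa)_{λ₁,λ₂} = Σ_{μ₁,μ₂} K_{λ₁,λ₂,μ₁,μ₂} a_{μ₁,μ₂}`.
Assume `K ∘ c̃₃ ∈ ℓ^{1,∞,1,∞}` and `K ∘ c̃₄ ∈ ℓ^{1,∞,1,∞}` (with
`c̃₃(x₁,x₂,x₃,x₄) = (x₂,x₃,x₁,x₄)`, `c̃₄(x₁,x₂,x₃,x₄) = (x₁,x₄,x₂,x₃)`), and moreover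
`K ∈ ℓ^{1,∞}(Λ×Λ)` and `K ∘ c̃₀ ∈ ℓ^{1,∞}(Λ×Λ)` (where `(K ∘ c̃₀)_{λ,μ} = K_{μ,λ}`).
Then `A` is bounded on `ℓ^{p,q}(Λ)` for every `1 ≤ p, q ≤ ∞`. -/
theorem schur_lpq_bounded
    {J : Type*} [Countable J] (K : J → J → J → J → ℂ)
    (h3 : (⨆ j4 : J, ∑' j3 : J, ⨆ j2 : J, ∑' j1 : J, (‖K j2 j3 j1 j4‖₊ : ℝ≥0∞)) ≠ ∞)
    (h4 : (⨆ j4 : J, ∑' j3 : J, ⨆ j2 : J, ∑' j1 : J, (‖K j1 j4 j2 j3‖₊ : ℝ≥0∞)) ≠ ∞)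
    (h0 : (⨆ m : J × J, ∑' l : J × J, (‖K l.1 l.2 m.1 m.2‖₊ : ℝ≥0∞)) ≠ ∞)
    (h0' : (⨆ m : J × J, ∑' l : J × J, (‖K m.1 m.2 l.1 l.2‖₊ : ℝ≥0∞)) ≠ ∞) :
    ∀ p q : ℝ≥0∞, 1 ≤ p → 1 ≤ q →
      ∃ C : ℝ≥0∞, C ≠ ∞ ∧
        ∀ a : J → J → ℂ,
          lpN q (fun l2 : J => lpN p (fun l1 : J =>
              (‖∑' m : J × J, K l1 l2 m.1 m.2 * a m.1 m.2‖₊ : ℝ≥0∞))) ≤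
            C * lpN q (fun l2 : J => lpN p (fun l1 : J => (‖a l1 l2‖₊ : ℝ≥0∞))) := by
  intro p q hp hq
  set k : J → J → J → J → ℝ≥0∞ := fun a b c d => (‖K a b c d‖₊ : ℝ≥0∞) with hk
  set C := ((⨆ j4 : J, ∑' j3 : J, ⨆ j2 : J, ∑' j1 : J, k j2 j3 j1 j4) +
      ⨆ j4 : J, ∑' j3 : J, ⨆ j2 : J, ∑' j1 : J, k j1 j4 j2 j3) +
    ((⨆ m : J × J, ∑' l : J × J, k l.1 l.2 m.1 m.2) +
      ⨆ m : J × J, ∑' l : J × J, k m.1 m.2 l.1 l.2) with hC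
  have hCtop : C ≠ ∞ :=
    ENNReal.add_ne_top.2 ⟨ENNReal.add_ne_top.2 ⟨h3, h4⟩, ENNReal.add_ne_top.2 ⟨h0, h0'⟩⟩
  refine ⟨C + 1, ENNReal.add_ne_top.2 ⟨hCtop, ENNReal.one_ne_top⟩, fun a => ?_⟩
  set A : J → ℝ≥0∞ := fun l2 => lpN p (fun l1 : J => (‖a l1 l2‖₊ : ℝ≥0∞)) with hA
  set N := lpN q A with hN
  by_cases hNtop : N = ∞
  · rw [hNtop, ENNReal.mul_top (by simp)]
    exact le_top
  obtain ⟨hx0, hx1⟩ := toReal_inv_mem_Icc hp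
  obtain ⟨hy0, hy1⟩ := toReal_inv_mem_Icc hq
  obtain ⟨s, hs, hAs⟩ := exists_weight_le_lpN_mul hq A hNtop
  have hAtop (j : J) : A j ≠ ∞ := by
    have hsj : s j ≠ ∞ := ((ENNReal.le_tsum j).trans hs).trans_lt ENNReal.one_lt_top |>.ne
    exact ((hAs j).trans_lt
      (ENNReal.mul_lt_top (lt_top_iff_ne_top.2 hNtop) (ENNReal.rpow_lt_top_of_nonneg hy0 hsj))).ne
  choose u hu hau using fun j : J =>
    exists_weight_le_lpN_mul hp (fun l1 : J => (‖a l1 j‖₊ : ℝ≥0∞)) (hAtop j)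
  refine (lpN_lpN_le_of_forall_weight hp hq _ (C := C * N) fun t w ht hw => ?_).trans
    (by gcongr; exact le_self_add)
  calc _ ≤ ∑' l2, ∑' l1, ∑' m : J × J,
        N * (k l1 l2 m.1 m.2 * ((s m.2 + t l2) * (u m.2 m.1 + w l2 l1))) := by
        refine ENNReal.tsum_le_tsum fun l2 => ENNReal.tsum_le_tsum fun l1 => ?_
        have hsum : (‖∑' m : J × J, K l1 l2 m.1 m.2 * a m.1 m.2‖₊ : ℝ≥0∞) ≤
            ∑' m : J × J, k l1 l2 m.1 m.2 * (‖a m.1 m.2‖₊ : ℝ≥0∞) := by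
          refine (enorm_tsum_le_tsum_enorm (f := fun m : J × J =>
            K l1 l2 m.1 m.2 * a m.1 m.2)).trans (le_of_eq ?_)
          exact tsum_congr fun m => enorm_mul _ _
        refine (mul_le_mul_right hsum _).trans ?_
        rw [← ENNReal.tsum_mul_left]
        refine ENNReal.tsum_le_tsum fun m => ?_
        calc t l2 ^ (1 - q.toReal⁻¹) * w l2 l1 ^ (1 - p.toReal⁻¹) *
              (k l1 l2 m.1 m.2 * (‖a m.1 m.2‖₊ : ℝ≥0∞))
            ≤ t l2 ^ (1 - q.toReal⁻¹) * w l2 l1 ^ (1 - p.toReal⁻¹) *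
              (k l1 l2 m.1 m.2 * (N * s m.2 ^ q.toReal⁻¹ * u m.2 m.1 ^ p.toReal⁻¹)) := by
              gcongr
              exact (hau m.2 m.1).trans (by gcongr; exact hAs m.2)
          _ = N * (k l1 l2 m.1 m.2 * ((s m.2 ^ q.toReal⁻¹ * t l2 ^ (1 - q.toReal⁻¹)) *
              (u m.2 m.1 ^ p.toReal⁻¹ * w l2 l1 ^ (1 - p.toReal⁻¹)))) := by ring
          _ ≤ _ := by
              gcongr
              · exact rpow_mul_rpow_one_sub_le_add hy0 hy1 _ _
              · exact rpow_mul_rpow_one_sub_le_add hx0 hx1 _ _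
    _ ≤ N * C := by
        simp only [ENNReal.tsum_mul_left]
        gcongr
        exact schur_weight_form_le k s t u w hs ht hu hw
    _ = C * N := mul_comm _ _

end
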